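/- Let N ≥ 2 and let γ : [0,1] → ℝ^N be three times continuously differentiable with γ'(t) ≠ 0 for all t, injective except possibly γ(0) = γ(1), and with γ'(0) = γ'(1) in case γ(0) = γ(1). For R > 0 define Ω_R := interior( ⋃_{t ∈ [0,1]} {Rγ(t) + v : v ∈ ℝ^N, |v| < 1, γ'(t)·v = 0} ). Define λ_{1,1} := inf { ∫ |∇u|² / ∫ u² : u smooth with compact support in the open unit ball B₁^{N−1} of ℝ^{N−1}, u not identically 0 }. Then for every ε > 0 there exists R₀ > 0 such that for all R ≥ R₀ and every smooth function u with compact support in Ω_R one has ∫_{Ω_R} |∇u|² dx ≥ (λ_{1,1} − ε) ∫_{Ω_R} u² dx. (Equivalently, liminf_{R→∞} λ₁(Ω_R) ≥ λ_{1,1}, where λ₁(Ω_R) is the bottom of the Dirichlet spectrum of −Δ on Ω_R given by the Rayleigh quotient.) -/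

import Mathlib

open MeasureTheory
open scoped RealInnerProductSpace

/-- The bottom of the Dirichlet spectrum of `-Δ` on an open set `U`, characterized as the
infimum of the Rayleigh quotient over nonzero smooth compactly supported functions in `U`. -/
noncomputable def rayleighQuotientInf {N : ℕ} (U : Set (EuclideanSpace ℝ (Fin N))) : ℝ :=
  ⨅ u : {u : EuclideanSpace ℝ (Fin N) → ℝ //
      ContDiff ℝ (⊤ : ℕ∞) u ∧ HasCompactSupport u ∧ tsupport u ⊆ U ∧ u ≠ 0},
    (∫ x, ‖fderiv ℝ u.1 x‖ ^ 2) / (∫ x, (u.1 x) ^ 2)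

/-- The open normal tubular neighborhood of radius `1` of the expanded curve `R • γ`:
`Ω_R = int ⋃_{t ∈ [0,1]} {Rγ(t) + v : |v| < 1, γ'(t)·v = 0}`. -/
noncomputable def tubularNbhd {N : ℕ} (γ : ℝ → EuclideanSpace ℝ (Fin N)) (R : ℝ) :
    Set (EuclideanSpace ℝ (Fin N)) :=
  interior (⋃ t ∈ Set.Icc (0 : ℝ) 1,
    {y | ∃ v : EuclideanSpace ℝ (Fin N),
      y = R • γ t + v ∧ ‖v‖ < 1 ∧ ⟪derivWithin γ (Set.Icc 0 1) t, v⟫ = 0})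

open Module Set Filter Topology

theorem HasCompactSupport.norm_sq {X F : Type*} [TopologicalSpace X] [NormedAddCommGroup F]
    {f : X → F} (hf : HasCompactSupport f) : HasCompactSupport fun x => ‖f x‖ ^ 2 :=
  HasCompactSupport.comp_left (g := fun t : F => ‖t‖ ^ 2) hf (by simp)

theorem Continuous.integrable_norm_sq {X F : Type*} [TopologicalSpace X] [MeasurableSpace X]
    [OpensMeasurableSpace X] {μ : Measure X} [IsFiniteMeasureOnCompacts μ] [NormedAddCommGroup F]
    {f : X → F} (hf : Continuous f) (hc : HasCompactSupport f) :
    Integrable (fun x => ‖f x‖ ^ 2) μ :=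
  (hf.norm.pow 2).integrable_of_hasCompactSupport hc.norm_sq

theorem Continuous.integrable_sq {X : Type*} [TopologicalSpace X] [MeasurableSpace X]
    [OpensMeasurableSpace X] {μ : Measure X} [IsFiniteMeasureOnCompacts μ]
    {f : X → ℝ} (hf : Continuous f) (hc : HasCompactSupport f) :
    Integrable (fun x => f x ^ 2) μ := by
  simpa only [Real.norm_eq_abs, sq_abs] using hf.integrable_norm_sq (μ := μ) hc

theorem rayleighQuotientInf_nonneg {n : ℕ} (U : Set (EuclideanSpace ℝ (Fin n))) :
    0 ≤ rayleighQuotientInf U :=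
  Real.iInf_nonneg fun _ => by positivity

theorem rayleighQuotientInf_mul_le {n : ℕ} {U : Set (EuclideanSpace ℝ (Fin n))}
    {f : EuclideanSpace ℝ (Fin n) → ℝ} (hf : ContDiff ℝ (⊤ : ℕ∞) f) (hc : HasCompactSupport f)
    (hU : tsupport f ⊆ U) :
    rayleighQuotientInf U * ∫ x, f x ^ 2 ≤ ∫ x, ‖fderiv ℝ f x‖ ^ 2 := by
  by_cases h0 : f = 0
  · subst h0; simp
  have hpos : 0 < ∫ x, f x ^ 2 := by
    obtain ⟨x, hx⟩ := Function.ne_iff.mp h0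
    refine Continuous.integral_pos_of_hasCompactSupport_nonneg_nonzero (x := x)
      (hf.continuous.pow 2) (by simpa using hc.norm_sq)
      (fun _ => sq_nonneg _) (pow_ne_zero 2 hx)
  rw [← le_div_iff₀ hpos]
  refine ciInf_le (f := fun u : {u : EuclideanSpace ℝ (Fin n) → ℝ //
      ContDiff ℝ (⊤ : ℕ∞) u ∧ HasCompactSupport u ∧ tsupport u ⊆ U ∧ u ≠ 0} =>
    (∫ x, ‖fderiv ℝ u.1 x‖ ^ 2) / (∫ x, (u.1 x) ^ 2)) ⟨0, ?_⟩ ⟨f, hf, hc, hU, h0⟩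
  rintro _ ⟨u, rfl⟩
  positivity

/-- Rescaled Poincaré inequality on a ball of radius `r` in any `n`-dimensional Euclidean space. -/
theorem rayleighQuotientInf_ball_mul_le {n : ℕ} {V : Type*} [NormedAddCommGroup V]
    [InnerProductSpace ℝ V] [FiniteDimensional ℝ V] [MeasurableSpace V] [BorelSpace V]
    (hn : finrank ℝ V = n) {r : ℝ} (hr : 0 < r) {v : V → ℝ} (hv : ContDiff ℝ (⊤ : ℕ∞) v)
    (hc : HasCompactSupport v) (hs : tsupport v ⊆ Metric.ball 0 r) :
    rayleighQuotientInf (Metric.ball (0 : EuclideanSpace ℝ (Fin n)) 1) * ∫ y, v y ^ 2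
      ≤ r ^ 2 * ∫ y, ‖fderiv ℝ v y‖ ^ 2 := by
  let L : EuclideanSpace ℝ (Fin n) ≃ₗᵢ[ℝ] V :=
    ((stdOrthonormalBasis ℝ V).reindex (finCongr hn)).repr.symm
  let S : EuclideanSpace ℝ (Fin n) ≃L[ℝ] V :=
    (ContinuousLinearEquiv.smulLeft (Units.mk0 r hr.ne')).trans L.toContinuousLinearEquiv
  have hS : ∀ x, S x = L (r • x) := fun x => rfl
  have hint : ∀ g : V → ℝ, ∫ x, g (S x) = (r ^ n)⁻¹ * ∫ y, g y := by
    intro g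
    simp only [hS]
    rw [Measure.integral_comp_smul volume (fun x => g (L x)) r,
      L.measurePreserving.integral_comp L.toHomeomorph.measurableEmbedding g]
    simp [abs_of_pos hr]
  have hsupp : tsupport (v ∘ S) ⊆ S ⁻¹' tsupport v :=
    closure_minimal (fun x hx => subset_tsupport v hx)
      ((isClosed_tsupport v).preimage S.continuous)
  have key := rayleighQuotientInf_mul_le (U := Metric.ball (0 : EuclideanSpace ℝ (Fin n)) 1)
    (f := v ∘ S) (hv.comp S.contDiff) (hc.comp_homeomorph S.toHomeomorph) (by
      intro x hx
      have := hs (hsupp hx)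
      rw [mem_ball_zero_iff, hS, L.norm_map, norm_smul, Real.norm_of_nonneg hr.le] at this
      rw [mem_ball_zero_iff]
      by_contra! h
      nlinarith)
  have hle : ∀ x, ‖fderiv ℝ (v ∘ S) x‖ ^ 2 ≤ r ^ 2 * ‖fderiv ℝ v (S x)‖ ^ 2 := by
    intro x
    rw [← mul_pow]
    refine pow_le_pow_left₀ (norm_nonneg _) ?_ 2
    refine ContinuousLinearMap.opNorm_le_bound _ (by positivity) fun w => ?_
    rw [fderiv_comp x (hv.differentiable (by simp) _) S.differentiableAt, S.fderiv]
    rw [ContinuousLinearMap.comp_apply]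
    refine (ContinuousLinearMap.le_opNorm _ _).trans (le_of_eq ?_)
    rw [ContinuousLinearEquiv.coe_coe, hS w, L.norm_map, norm_smul, Real.norm_of_nonneg hr.le]
    ring
  have hcont : Continuous fun y => ‖fderiv ℝ v y‖ ^ 2 :=
    ((hv.continuous_fderiv (by simp)).norm).pow 2
  have hI : Integrable fun x => r ^ 2 * ‖fderiv ℝ v (S x)‖ ^ 2 := by
    exact ((hcont.comp S.continuous).integrable_of_hasCompactSupport
      ((hc.fderiv ℝ).norm_sq.comp_homeomorph S.toHomeomorph)).const_mul _
  have h2 := integral_mono_of_nonneg (ae_of_all _ fun x => by positivity) hI (ae_of_all _ hle)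
  have h3 := key.trans h2
  rw [integral_const_mul, hint (fun y => ‖fderiv ℝ v y‖ ^ 2)] at h3
  simp only [Function.comp_apply] at h3
  rw [hint (fun y => v y ^ 2)] at h3
  have hrn : 0 < (r ^ n)⁻¹ := by positivity
  refine le_of_mul_le_mul_left ?_ hrn
  linarith

theorem integral_eq_integral_integral_orthogonal {E : Type*} [NormedAddCommGroup E]
    [InnerProductSpace ℝ E] [FiniteDimensional ℝ E] [MeasurableSpace E] [BorelSpace E]
    (K : Submodule ℝ E) (p : E) {f : E → ℝ} (hf : Integrable f) :
    Integrable (fun k : K => ∫ y : Kᗮ, f (p + k + y)) ∧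
    ∫ x, f x = ∫ k : K, ∫ y : Kᗮ, f (p + k + y) := by
  let e : K × Kᗮ ≃ᵐ E := (MeasurableEquiv.toLp 2 (K × Kᗮ)).trans
    (K.orthogonalDecomposition.symm.toHomeomorph.toMeasurableEquiv.trans
      (Homeomorph.addLeft p).toMeasurableEquiv)
  have he : ∀ z, e z = p + z.1 + z.2 := fun z => by
    simp [e, add_assoc]
  have hmp : MeasurePreserving e :=
    (measurePreserving_add_left volume p).comp
      (K.orthogonalDecomposition.symm.measurePreserving.comp
        (WithLp.volume_preserving_toLp K Kᗮ))
  have hI : Integrable (fun z => f (e z)) := (hmp.integrable_comp_emb e.measurableEmbedding).2 hf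
  have h1 := hmp.integral_comp e.measurableEmbedding f
  simp only [he, Measure.volume_eq_prod] at hI h1
  exact ⟨hI.integral_prod_left, by rw [← h1, integral_prod _ hI]⟩

/-- Poincaré inequality for functions supported in a straight cylinder of radius `r`. -/
theorem rayleighQuotientInf_cylinder_mul_le {n : ℕ} {E : Type*} [NormedAddCommGroup E]
    [InnerProductSpace ℝ E] [FiniteDimensional ℝ E] [MeasurableSpace E] [BorelSpace E]
    (K : Submodule ℝ E) (hn : finrank ℝ Kᗮ = n) (p : E) {r : ℝ} (hr : 0 < r) {w : E → ℝ}
    (hw : ContDiff ℝ (⊤ : ℕ∞) w) (hc : HasCompactSupport w)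
    (hs : ∀ x ∈ tsupport w, ‖Kᗮ.starProjection (x - p)‖ < r) :
    rayleighQuotientInf (Metric.ball (0 : EuclideanSpace ℝ (Fin n)) 1) * ∫ x, w x ^ 2
      ≤ r ^ 2 * ∫ x, ‖fderiv ℝ w x‖ ^ 2 := by
  have hI1 : Integrable fun x => w x ^ 2 := hw.continuous.integrable_sq hc
  have hcont : Continuous fun y => ‖fderiv ℝ w y‖ ^ 2 :=
    ((hw.continuous_fderiv (by simp)).norm).pow 2
  have hcs : HasCompactSupport fun y => ‖fderiv ℝ w y‖ ^ 2 :=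
    (hc.fderiv ℝ).norm_sq
  have hI2 : Integrable fun x => ‖fderiv ℝ w x‖ ^ 2 := hcont.integrable_of_hasCompactSupport hcs
  obtain ⟨i1, e1⟩ := integral_eq_integral_integral_orthogonal K p hI1
  obtain ⟨i2, e2⟩ := integral_eq_integral_integral_orthogonal K p hI2
  rw [e1, e2, ← integral_const_mul, ← integral_const_mul]
  refine integral_mono (i1.const_mul _) (i2.const_mul _) fun k => ?_
  have hemb : IsClosedEmbedding fun y : Kᗮ => p + k + (y : E) :=
    (Homeomorph.addLeft (p + (k : E))).isClosedEmbedding.comp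
      Kᗮ.closed_of_finiteDimensional.isClosedEmbedding_subtypeVal
  have hsm : ContDiff ℝ (⊤ : ℕ∞) fun y : Kᗮ => p + k + (y : E) :=
    contDiff_const.add Kᗮ.subtypeL.contDiff
  have hder : ∀ y : Kᗮ, HasFDerivAt (fun y : Kᗮ => p + k + (y : E)) Kᗮ.subtypeL y :=
    fun y => Kᗮ.subtypeL.hasFDerivAt.const_add _
  refine (rayleighQuotientInf_ball_mul_le hn hr (v := fun y : Kᗮ => w (p + k + y))
    (hw.comp hsm) (hc.comp_isClosedEmbedding hemb) ?_).trans ?_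
  · intro y hy
    have hy' : p + k + (y : E) ∈ tsupport w :=
      closure_minimal (s := Function.support fun y : Kᗮ => w (p + k + y))
        (fun x hx => subset_tsupport w hx)
        ((isClosed_tsupport w).preimage hemb.continuous) hy
    have h := hs _ hy'
    have hk : Kᗮ.starProjection (k : E) = 0 := by
      rw [Submodule.starProjection_apply_eq_zero_iff]
      exact K.le_orthogonal_orthogonal k.2
    rw [add_assoc, add_sub_cancel_left, map_add, hk, zero_add,
      Submodule.starProjection_eq_self_iff.2 y.2] at h
    simpa using h
  · refine mul_le_mul_of_nonneg_left ?_ (sq_nonneg r)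
    refine integral_mono_of_nonneg (ae_of_all _ fun x => by positivity) ?_ (ae_of_all _ fun y => ?_)
    · exact (hcont.comp hemb.continuous).integrable_of_hasCompactSupport
        (hcs.comp_isClosedEmbedding hemb)
    · refine pow_le_pow_left₀ (norm_nonneg _) ?_ 2
      have h : HasFDerivAt (fun y : Kᗮ => w (p + k + y))
          ((fderiv ℝ w (p + k + y)).comp Kᗮ.subtypeL) y :=
        (hw.differentiable (by simp) (p + k + y)).hasFDerivAt.comp y (hder y)
      rw [h.fderiv]
      refine (ContinuousLinearMap.opNorm_comp_le _ _).trans ?_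
      exact mul_le_of_le_one_right (norm_nonneg _) (Submodule.norm_subtypeL_le _)

section Localization

variable {E : Type*} [NormedAddCommGroup E] [InnerProductSpace ℝ E] [FiniteDimensional ℝ E]
  [MeasurableSpace E] [BorelSpace E]

theorem exists_cutoff_integral_fderiv_sq_le {κ : ℝ} (hκ : 0 < κ) :
    ∃ φ : E → ℝ, ContDiff ℝ (⊤ : ℕ∞) φ ∧ HasCompactSupport φ ∧ 0 < ∫ x, φ x ^ 2 ∧
      ∫ x, ‖fderiv ℝ φ x‖ ^ 2 ≤ κ * ∫ x, φ x ^ 2 := by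
  let ψ : ContDiffBump (0 : E) := ⟨1, 2, one_pos, one_lt_two⟩
  have hψ : ContDiff ℝ (⊤ : ℕ∞) ψ := ψ.contDiff
  have hB : 0 < ∫ x, ψ x ^ 2 := by
    refine Continuous.integral_pos_of_hasCompactSupport_nonneg_nonzero (x := 0)
      (ψ.continuous.pow 2) (by simpa using ψ.hasCompactSupport.norm_sq)
      (fun _ => sq_nonneg _) (pow_ne_zero 2 ?_)
    rw [ψ.one_of_mem_closedBall (by simp [ψ])]
    exact one_ne_zero
  set A := ∫ x, ‖fderiv ℝ ψ x‖ ^ 2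
  set B := ∫ x, ψ x ^ 2
  have hA : 0 ≤ A := by positivity
  obtain ⟨c, hc, hc2⟩ : ∃ c : ℝ, 0 < c ∧ c ^ 2 = κ * B / (A + 1) :=
    ⟨√(κ * B / (A + 1)), by positivity, Real.sq_sqrt (by positivity)⟩
  have hder : ∀ x, fderiv ℝ (fun x => ψ (c • x)) x = c • fderiv ℝ ψ (c • x) :=
    fun x => fderiv_comp_smul c
  have e1 : ∫ x, ψ (c • x) ^ 2 = |(c ^ finrank ℝ E)⁻¹| * B :=
    Measure.integral_comp_smul volume (fun x => ψ x ^ 2) c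
  have e2 : ∫ x, ‖fderiv ℝ (fun x => ψ (c • x)) x‖ ^ 2
      = c ^ 2 * (|(c ^ finrank ℝ E)⁻¹| * A) := by
    simp only [hder, norm_smul, mul_pow, Real.norm_eq_abs, sq_abs]
    rw [integral_const_mul]
    congr 1
    exact Measure.integral_comp_smul volume (fun x => ‖fderiv ℝ ψ x‖ ^ 2) c
  have hD : 0 < |(c ^ finrank ℝ E)⁻¹| := by positivity
  refine ⟨fun x => ψ (c • x), hψ.comp (contDiff_const_smul c),
    ψ.hasCompactSupport.comp_homeomorph (Homeomorph.smulOfNeZero c hc.ne'), ?_, ?_⟩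
  · rw [e1]; positivity
  · rw [e1, e2]
    have : c ^ 2 * A ≤ κ * B := by
      rw [hc2, div_mul_eq_mul_div, div_le_iff₀ (by positivity)]
      have : 0 < κ * B := by positivity
      nlinarith
    nlinarith

theorem norm_add_sq_le_of_pos {F : Type*} [NormedAddCommGroup F] (a b : F) {δ : ℝ} (hδ : 0 < δ) :
    ‖a + b‖ ^ 2 ≤ (1 + δ) * ‖a‖ ^ 2 + (1 + δ⁻¹) * ‖b‖ ^ 2 := by
  have h1 : ‖a + b‖ ^ 2 ≤ (‖a‖ + ‖b‖) ^ 2 :=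
    pow_le_pow_left₀ (norm_nonneg _) (norm_add_le a b) 2
  have h2 : 0 ≤ δ⁻¹ * (δ * ‖a‖ - ‖b‖) ^ 2 := by positivity
  have h3 : δ⁻¹ * (δ * ‖a‖ - ‖b‖) ^ 2
      = δ * ‖a‖ ^ 2 - 2 * ‖a‖ * ‖b‖ + δ⁻¹ * ‖b‖ ^ 2 := by
    field_simp; ring
  nlinarith

/-- If a Poincaré inequality with constant `m` holds for all localizations of `u` by translates of
a cutoff function `φ`, then it holds for `u` up to an error controlled by `∇φ`. -/
theorem mul_integral_sq_le_of_localized {u φ : E → ℝ} (hu : ContDiff ℝ (⊤ : ℕ∞) u)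
    (huc : HasCompactSupport u) (hφ : ContDiff ℝ (⊤ : ℕ∞) φ) (hφc : HasCompactSupport φ)
    {m δ : ℝ} (hδ : 0 < δ)
    (h : ∀ z, m * ∫ x, (φ (z - x) * u x) ^ 2
      ≤ ∫ x, ‖fderiv ℝ (fun x => φ (z - x) * u x) x‖ ^ 2) :
    m * ((∫ x, u x ^ 2) * ∫ x, φ x ^ 2) ≤
      (1 + δ) * ((∫ x, ‖fderiv ℝ u x‖ ^ 2) * ∫ x, φ x ^ 2) +
      (1 + δ⁻¹) * ((∫ x, u x ^ 2) * ∫ x, ‖fderiv ℝ φ x‖ ^ 2) := by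
  have iu := hu.continuous.integrable_sq (μ := volume) huc
  have iφ := hφ.continuous.integrable_sq (μ := volume) hφc
  have cdu := hu.continuous_fderiv (by simp)
  have cdφ := hφ.continuous_fderiv (by simp)
  have idu := cdu.integrable_norm_sq (μ := volume) (huc.fderiv ℝ)
  have idφ := cdφ.integrable_norm_sq (μ := volume) (hφc.fderiv ℝ)
  have conv : ∀ {f g : E → ℝ}, Integrable f → Integrable g →
      Integrable (fun z => ∫ x, f x * g (z - x)) ∧
      ∫ z, ∫ x, f x * g (z - x) = (∫ x, f x) * ∫ x, g x := fun hf hg =>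
    ⟨hf.integrable_convolution (ContinuousLinearMap.mul ℝ ℝ) hg,
      integral_convolution (ContinuousLinearMap.mul ℝ ℝ) hf hg⟩
  obtain ⟨i1, e1⟩ := conv iu iφ
  obtain ⟨i2, e2⟩ := conv idu iφ
  obtain ⟨i3, e3⟩ := conv iu idφ
  rw [← e1, ← e2, ← e3, ← integral_const_mul, ← integral_const_mul, ← integral_const_mul,
    ← integral_add (i2.const_mul _) (i3.const_mul _)]
  refine integral_mono (i1.const_mul _) ((i2.const_mul _).add (i3.const_mul _)) fun z => ?_
  have I : ∀ {f g : E → ℝ}, Continuous f → Continuous g → HasCompactSupport f →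
      Integrable fun x => f x * g (z - x) := fun hf hg hc =>
    (hf.mul (hg.comp (continuous_const.sub continuous_id))).integrable_of_hasCompactSupport
      hc.mul_right
  have j2 : Integrable fun x => ‖fderiv ℝ u x‖ ^ 2 * φ (z - x) ^ 2 :=
    I (cdu.norm.pow 2) (hφ.continuous.pow 2) (huc.fderiv ℝ).norm_sq
  have j3 : Integrable fun x => u x ^ 2 * ‖fderiv ℝ φ (z - x)‖ ^ 2 :=
    I (f := fun x => u x ^ 2) (hu.continuous.pow 2) (cdφ.norm.pow 2) (by simpa using huc.norm_sq)
  have hz := h z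
  simp only [mul_pow, mul_comm (φ _ ^ 2)] at hz
  refine hz.trans ?_
  rw [← integral_const_mul, ← integral_const_mul,
    ← integral_add (j2.const_mul _) (j3.const_mul _)]
  refine integral_mono_of_nonneg (ae_of_all _ fun x => by positivity)
    ((j2.const_mul _).add (j3.const_mul _)) (ae_of_all _ fun x => ?_)
  have hd1 : HasFDerivAt (fun x => φ (z - x)) (-fderiv ℝ φ (z - x)) x := by
    have h' : HasFDerivAt (fun x => φ (z - x)) ((fderiv ℝ φ (z - x)).comp (-.id ℝ E)) x :=
      (hφ.differentiable (by simp) (z - x)).hasFDerivAt.comp x ((hasFDerivAt_id x).const_sub z)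
    simpa only [ContinuousLinearMap.comp_neg, ContinuousLinearMap.comp_id] using h'
  have hd := (hd1.mul (hu.differentiable (by simp) x).hasFDerivAt).fderiv
  have hd' : fderiv ℝ (fun x => φ (z - x) * u x) x
      = φ (z - x) • fderiv ℝ u x + u x • -fderiv ℝ φ (z - x) := hd
  simp only [hd']
  refine (norm_add_sq_le_of_pos _ _ hδ).trans (le_of_eq ?_)
  simp only [norm_smul, norm_neg, mul_pow, Real.norm_eq_abs, sq_abs]
  ring

end Localization

section Curve

variable {E : Type*} [NormedAddCommGroup E] [NormedSpace ℝ E]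

theorem exists_uniform_deriv_approx {γ g : ℝ → E} {a b : ℝ}
    (hγ : ∀ t ∈ Icc a b, HasDerivWithinAt γ (g t) (Icc a b) t) (hg : ContinuousOn g (Icc a b))
    {κ : ℝ} (hκ : 0 < κ) :
    ∃ d > 0, ∀ s ∈ Icc a b, ∀ t ∈ Icc a b, |t - s| < d →
      ‖γ t - γ s - (t - s) • g s‖ ≤ κ * |t - s| ∧ ‖g t - g s‖ ≤ κ := by
  obtain ⟨d, hd, H⟩ := Metric.uniformContinuousOn_iff.1
    (isCompact_Icc.uniformContinuousOn_of_continuous hg) κ hκ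
  have Hg : ∀ s ∈ Icc a b, ∀ t ∈ Icc a b, |t - s| < d → ‖g t - g s‖ ≤ κ := fun s hs t ht h => by
    simpa only [dist_eq_norm] using (H t ht s hs (by rwa [Real.dist_eq])).le
  refine ⟨d, hd, fun s hs t ht hst => ⟨?_, Hg s hs t ht hst⟩⟩
  have hsub : uIcc s t ⊆ Icc a b := uIcc_subset_Icc hs ht
  have key := Convex.norm_image_sub_le_of_norm_hasDerivWithin_le
    (f := fun x => γ x - x • g s) (f' := fun x => g x - g s) (s := uIcc s t) (x := s) (y := t)
    (C := κ) (fun x hx => by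
      have h := ((hγ x (hsub hx)).mono hsub).sub ((hasDerivWithinAt_id x _).smul_const (g s))
      rw [one_smul] at h
      exact h)
    (fun x hx => Hg s hs x (hsub hx) ((abs_sub_left_of_mem_uIcc hx).trans_lt hst))
    (convex_uIcc s t) left_mem_uIcc right_mem_uIcc
  rw [Real.norm_eq_abs] at key
  convert key using 2
  rw [sub_smul]; abel

theorem norm_sub_smul_le_of_approx {v w : E} {b m κ η : ℝ} (hη : 0 < η)
    (hκ : κ * (1 + η) ≤ η * m) (hv : m ≤ ‖v‖) (h : ‖w - b • v‖ ≤ κ * |b|) :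
    ‖w - b • v‖ ≤ η * ‖w‖ := by
  have h1 : |b| * ‖v‖ ≤ ‖w‖ + ‖w - b • v‖ := by
    have := norm_sub_le w (w - b • v)
    rwa [sub_sub_cancel, norm_smul, Real.norm_eq_abs] at this
  nlinarith [mul_le_mul_of_nonneg_left hv (abs_nonneg b), abs_nonneg b]

/-- A short chord of a regular simple (possibly closed) `C¹` curve is almost tangent to it. -/
theorem exists_chord_almost_tangent {γ g : ℝ → E}
    (hγ : ∀ t ∈ Icc (0 : ℝ) 1, HasDerivWithinAt γ (g t) (Icc 0 1) t)
    (hg : ContinuousOn g (Icc 0 1)) (hg0 : ∀ t ∈ Icc (0 : ℝ) 1, g t ≠ 0)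
    (hinj : ∀ s ∈ Icc (0 : ℝ) 1, ∀ t ∈ Icc (0 : ℝ) 1, γ s = γ t →
      s = t ∨ (s = 0 ∧ t = 1) ∨ (s = 1 ∧ t = 0))
    (hper : γ 0 = γ 1 → g 0 = g 1) {η : ℝ} (hη : 0 < η) :
    ∃ ρ > 0, ∀ s ∈ Icc (0 : ℝ) 1, ∀ t ∈ Icc (0 : ℝ) 1, ‖γ t - γ s‖ ≤ ρ →
      ∃ a : ℝ, ‖γ t - γ s - a • g s‖ ≤ η * ‖γ t - γ s‖ := by
  have hcont : ContinuousOn γ (Icc 0 1) := fun t ht => (hγ t ht).continuousWithinAt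
  obtain ⟨m, hm, hmg⟩ : ∃ m > 0, ∀ t ∈ Icc (0 : ℝ) 1, m ≤ ‖g t‖ := by
    obtain ⟨t, ht, hmin⟩ := isCompact_Icc.exists_isMinOn (nonempty_Icc.2 zero_le_one) hg.norm
    exact ⟨‖g t‖, norm_pos_iff.2 (hg0 t ht), fun s hs => hmin hs⟩
  obtain ⟨κ, hκ, hκm⟩ : ∃ κ > 0, κ * (1 + η) ≤ η * m :=
    ⟨η * m / (1 + η), by positivity, (div_mul_cancel₀ _ (by positivity)).le⟩
  obtain ⟨d, hd, H⟩ := exists_uniform_deriv_approx hγ hg (half_pos hκ)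
  have m0 : (0 : ℝ) ∈ Icc (0 : ℝ) 1 := by simp
  have m1 : (1 : ℝ) ∈ Icc (0 : ℝ) 1 := by simp
  have near : ∀ p q : ℝ, {z : ℝ × ℝ | |z.1 - p| < d / 2 ∧ |z.2 - q| < d / 2} ∈ 𝓝 (p, q) := by
    intro p q
    filter_upwards [Metric.ball_mem_nhds (p, q) (half_pos hd)] with z hz
    simpa [Prod.dist_eq, Real.dist_eq] using hz
  have across : ∀ p ∈ Icc (0 : ℝ) 1, ∀ q ∈ Icc (0 : ℝ) 1, γ p = γ q → g p = g q →
      ∀ s ∈ Icc (0 : ℝ) 1, ∀ t ∈ Icc (0 : ℝ) 1, |s - p| < d → |t - q| < d →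
      |t - q| + |s - p| = |(t - q) - (s - p)| →
      ‖γ t - γ s - ((t - q) - (s - p)) • g s‖ ≤ η * ‖γ t - γ s‖ := by
    intro p hp q hq hpq gpq s hs t ht hsp htq hb
    refine norm_sub_smul_le_of_approx hη hκm (hmg s hs) ?_
    have h1 := (H q hq t ht htq).1
    obtain ⟨h2, h3⟩ := H p hp s hs hsp
    set b := (t - q) - (s - p)
    have e : γ t - γ s - b • g s = (γ t - γ q - (t - q) • g q)
        - (γ s - γ p - (s - p) • g p) - b • (g s - g p) := by
      rw [hpq, gpq, show b = (t - q) - (s - p) from rfl]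
      module
    have h4 : ‖b • (g s - g p)‖ ≤ |b| * (κ / 2) := by
      rw [norm_smul, Real.norm_eq_abs]; gcongr
    rw [e]
    refine ((norm_sub_le _ _).trans (add_le_add_left (norm_sub_le _ _) _)).trans ?_
    rw [← hb] at h4 ⊢
    linarith
  let P : Set (ℝ × ℝ) → Prop := fun S => ∃ ρ > 0, ∀ z ∈ S, ‖γ z.2 - γ z.1‖ ≤ ρ →
    ∃ a : ℝ, ‖γ z.2 - γ z.1 - a • g z.1‖ ≤ η * ‖γ z.2 - γ z.1‖
  suffices hP : P (Icc 0 1 ×ˢ Icc 0 1) by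
    obtain ⟨ρ, hρ, h⟩ := hP
    exact ⟨ρ, hρ, fun s hs t ht => h (s, t) ⟨hs, ht⟩⟩
  refine (isCompact_Icc.prod isCompact_Icc).induction_on (p := P) ⟨1, one_pos, by simp⟩
    (fun S T hST ⟨ρ, hρ, h⟩ => ⟨ρ, hρ, fun z hz => h z (hST hz)⟩) ?_ ?_
  · rintro S T ⟨ρ, hρ, h⟩ ⟨ρ', hρ', h'⟩
    refine ⟨min ρ ρ', lt_min hρ hρ', ?_⟩
    rintro z (hz | hz) hle
    · exact h z hz (hle.trans (min_le_left _ _))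
    · exact h' z hz (hle.trans (min_le_right _ _))
  rintro ⟨p, q⟩ ⟨hp, hq⟩
  by_cases hpq : γ p = γ q
  · refine ⟨_, inter_mem_nhdsWithin _ (near p q), 1, one_pos, ?_⟩
    rintro ⟨s, t⟩ ⟨⟨hs, ht⟩, hsp, htq⟩ -
    simp only at hs ht hsp htq ⊢
    rcases hinj p hp q hq hpq with rfl | ⟨rfl, rfl⟩ | ⟨rfl, rfl⟩
    · refine ⟨t - s, norm_sub_smul_le_of_approx hη hκm (hmg s hs) ?_⟩
      have hst : |t - s| < d := by
        have := abs_sub_le t p s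
        rw [abs_sub_comm p s] at this
        linarith
      nlinarith [(H s hs t ht hst).1, abs_nonneg (t - s)]
    · refine ⟨_, across 0 hp 1 hq hpq (hper hpq) s hs t ht (by linarith) (by linarith) ?_⟩
      rw [abs_of_nonpos (by linarith [ht.2]), abs_of_nonneg (by linarith [hs.1]),
        abs_of_nonpos (by linarith [ht.2, hs.1])]
      ring
    · refine ⟨_, across 1 hp 0 hq hpq (hper hpq.symm).symm s hs t ht
        (by linarith) (by linarith) ?_⟩
      rw [abs_of_nonneg (by linarith [ht.1]), abs_of_nonpos (by linarith [hs.2]),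
        abs_of_nonneg (by linarith [ht.1, hs.2])]
      ring
  · have hc : ContinuousWithinAt (fun z : ℝ × ℝ => ‖γ z.2 - γ z.1‖) (Icc 0 1 ×ˢ Icc 0 1) (p, q) :=
      (((hcont.comp continuousOn_snd fun z hz => hz.2).sub
        (hcont.comp continuousOn_fst fun z hz => hz.1)).norm) (p, q) ⟨hp, hq⟩
    have hpos : 0 < ‖γ q - γ p‖ := norm_pos_iff.2 (sub_ne_zero.2 fun h => hpq h.symm)
    refine ⟨_, hc (lt_mem_nhds (half_lt_self hpos)), _, half_pos hpos, ?_⟩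
    intro z hz hle
    exact absurd hle (not_le.2 hz)

end Curve

/-- Inside any ball of fixed radius, the tube around a highly expanded curve is contained in a
straight cylinder of radius slightly larger than `1`. -/
theorem exists_cylinder_of_tubularNbhd {n : ℕ} {γ : ℝ → EuclideanSpace ℝ (Fin (n + 1))}
    (hγ : ContDiffOn ℝ 1 γ (Icc 0 1))
    (hγ' : ∀ t ∈ Icc (0 : ℝ) 1, derivWithin γ (Icc 0 1) t ≠ 0)
    (hinj : ∀ s ∈ Icc (0 : ℝ) 1, ∀ t ∈ Icc (0 : ℝ) 1, γ s = γ t →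
      s = t ∨ (s = 0 ∧ t = 1) ∨ (s = 1 ∧ t = 0))
    (hper : γ 0 = γ 1 → derivWithin γ (Icc 0 1) 0 = derivWithin γ (Icc 0 1) 1)
    {δ ℓ : ℝ} (hδ : 0 < δ) (hℓ : 0 < ℓ) :
    ∃ R₀ > 0, ∀ R ≥ R₀, ∀ z : EuclideanSpace ℝ (Fin (n + 1)),
      ∃ (K : Submodule ℝ (EuclideanSpace ℝ (Fin (n + 1)))) (p : EuclideanSpace ℝ (Fin (n + 1))),
        finrank ℝ Kᗮ = n ∧
        ∀ x ∈ tubularNbhd γ R, ‖z - x‖ ≤ ℓ → ‖Kᗮ.starProjection (x - p)‖ < 1 + δ := by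
  set g := derivWithin γ (Icc 0 1)
  have hu : UniqueDiffOn ℝ (Icc (0 : ℝ) 1) := uniqueDiffOn_Icc zero_lt_one
  have hd : ∀ t ∈ Icc (0 : ℝ) 1, HasDerivWithinAt γ (g t) (Icc 0 1) t := fun t ht =>
    (hγ.differentiableOn one_ne_zero t ht).hasDerivWithinAt
  have hg : ContinuousOn g (Icc 0 1) := hγ.continuousOn_derivWithin hu le_rfl
  obtain ⟨ρ, hρ, H⟩ := exists_chord_almost_tangent hd hg hγ' hinj hper
    (η := δ / (2 * ℓ + 2)) (by positivity)
  have hfin : ∀ t ∈ Icc (0 : ℝ) 1, finrank ℝ (ℝ ∙ g t)ᗮ = n := fun t ht => by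
    have : Fact (finrank ℝ (EuclideanSpace ℝ (Fin (n + 1))) = n + 1) := ⟨by simp⟩
    exact Submodule.finrank_orthogonal_span_singleton (hγ' t ht)
  have hmem : ∀ R, ∀ x ∈ tubularNbhd γ R, ∃ t ∈ Icc (0 : ℝ) 1, ‖x - R • γ t‖ < 1 := by
    intro R x hx
    obtain ⟨t, ht, v, rfl, hv, -⟩ := mem_iUnion₂.1 (interior_subset hx)
    exact ⟨t, ht, by simpa using hv⟩
  refine ⟨(2 * ℓ + 2) / ρ, by positivity, fun R hR z => ?_⟩
  have hR0 : 0 < R := lt_of_lt_of_le (by positivity) hR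
  by_cases hne : ∃ y ∈ tubularNbhd γ R, ‖z - y‖ ≤ ℓ
  swap
  · exact ⟨ℝ ∙ g 0, 0, hfin 0 (by simp), fun x hx hxz => absurd ⟨x, hx, hxz⟩ hne⟩
  obtain ⟨y, hy, hyz⟩ := hne
  obtain ⟨s, hs, hys⟩ := hmem R y hy
  refine ⟨ℝ ∙ g s, R • γ s, hfin s hs, fun x hx hxz => ?_⟩
  obtain ⟨t, ht, hxt⟩ := hmem R x hx
  have hM : R * ‖γ t - γ s‖ ≤ 2 * ℓ + 2 := by
    have e : R • (γ t - γ s) = ((z - y) - (z - x)) + ((y - R • γ s) - (x - R • γ t)) := by module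
    rw [← Real.norm_of_nonneg hR0.le, ← norm_smul, e]
    refine (norm_add_le _ _).trans ?_
    linarith [norm_sub_le (z - y) (z - x), norm_sub_le (y - R • γ s) (x - R • γ t)]
  have hle : ‖γ t - γ s‖ ≤ ρ := by
    rw [ge_iff_le, div_le_iff₀ hρ] at hR
    exact le_of_mul_le_mul_left (hM.trans hR) hR0
  obtain ⟨a, ha⟩ := H s hs t ht hle
  have hproj : (ℝ ∙ g s)ᗮ.starProjection ((R * a) • g s) = 0 := by
    rw [Submodule.starProjection_apply_eq_zero_iff]
    exact Submodule.le_orthogonal_orthogonal _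
      (Submodule.smul_mem _ _ (Submodule.mem_span_singleton_self _))
  have e : x - R • γ s = (R * a) • g s + (R • (γ t - γ s - a • g s) + (x - R • γ t)) := by module
  rw [e, map_add, hproj, zero_add]
  refine (Submodule.norm_starProjection_apply_le _ _).trans_lt ((norm_add_le _ _).trans_lt ?_)
  rw [norm_smul, Real.norm_of_nonneg hR0.le]
  have : R * ‖γ t - γ s - a • g s‖ ≤ δ := by
    calc R * ‖γ t - γ s - a • g s‖ ≤ R * (δ / (2 * ℓ + 2) * ‖γ t - γ s‖) := by gcongr
      _ = δ / (2 * ℓ + 2) * (R * ‖γ t - γ s‖) := by ring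
      _ ≤ δ / (2 * ℓ + 2) * (2 * ℓ + 2) := by gcongr
      _ = δ := div_mul_cancel₀ _ (by positivity)
  linarith

theorem stmt_15 (N : ℕ) (hN : 2 ≤ N) (γ : ℝ → EuclideanSpace ℝ (Fin N))
    (hγ : ContDiffOn ℝ 3 γ (Set.Icc 0 1))
    (hγ' : ∀ t ∈ Set.Icc (0 : ℝ) 1, derivWithin γ (Set.Icc 0 1) t ≠ 0)
    (hinj : ∀ s ∈ Set.Icc (0 : ℝ) 1, ∀ t ∈ Set.Icc (0 : ℝ) 1, γ s = γ t →
      s = t ∨ (s = 0 ∧ t = 1) ∨ (s = 1 ∧ t = 0))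
    (hper : γ 0 = γ 1 → derivWithin γ (Set.Icc 0 1) 0 = derivWithin γ (Set.Icc 0 1) 1) :
    ∀ ε > (0 : ℝ), ∃ R₀ > (0 : ℝ), ∀ R ≥ R₀,
      ∀ u : EuclideanSpace ℝ (Fin N) → ℝ,
        ContDiff ℝ (⊤ : ℕ∞) u → HasCompactSupport u → tsupport u ⊆ tubularNbhd γ R →
        (rayleighQuotientInf (Metric.ball (0 : EuclideanSpace ℝ (Fin (N - 1))) 1) - ε)
            * ∫ x, (u x) ^ 2
          ≤ ∫ x, ‖fderiv ℝ u x‖ ^ 2 := by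
  obtain ⟨n, rfl⟩ : ∃ n, N = n + 1 := ⟨N - 1, by omega⟩
  intro ε hε
  rw [Nat.add_sub_cancel]
  set μ := rayleighQuotientInf (Metric.ball (0 : EuclideanSpace ℝ (Fin n)) 1)
  have hμ : 0 ≤ μ := rayleighQuotientInf_nonneg _
  obtain ⟨δ, hδ, hδε⟩ : ∃ δ > 0, 6 * (μ * δ) ≤ ε := by
    refine ⟨ε / (6 * (μ + 1)), by positivity, ?_⟩
    rw [mul_div_assoc', mul_div_assoc', div_le_iff₀ (by positivity)]
    nlinarith
  obtain ⟨φ, hφ, hφc, hφpos, hφle⟩ := exists_cutoff_integral_fderiv_sq_le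
    (E := EuclideanSpace ℝ (Fin (n + 1))) (κ := δ * ε / 2) (by positivity)
  obtain ⟨ℓ, hℓ, hφℓ⟩ := hφc.isCompact.isBounded.exists_pos_norm_le
  obtain ⟨R₀, hR₀, H⟩ := exists_cylinder_of_tubularNbhd (hγ.of_le (by norm_num)) hγ' hinj hper
    hδ hℓ
  refine ⟨R₀, hR₀, fun R hR u hu huc hus => ?_⟩
  have hr : 0 < 1 + δ := by linarith
  have hloc : ∀ z, μ / (1 + δ) ^ 2 * ∫ x, (φ (z - x) * u x) ^ 2
      ≤ ∫ x, ‖fderiv ℝ (fun x => φ (z - x) * u x) x‖ ^ 2 := by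
    intro z
    obtain ⟨K, p, hK, hcyl⟩ := H R hR z
    rw [div_mul_eq_mul_div, div_le_iff₀ (by positivity), mul_comm (∫ x, _)]
    refine rayleighQuotientInf_cylinder_mul_le K hK p hr
      ((hφ.comp (contDiff_const.sub contDiff_id)).mul hu) huc.mul_left fun x hx => ?_
    have hsub : tsupport (fun x => φ (z - x)) ⊆ (fun x => z - x) ⁻¹' tsupport φ :=
      closure_minimal (fun y hy => subset_tsupport φ hy)
        ((isClosed_tsupport φ).preimage (continuous_const.sub continuous_id))
    exact hcyl x (hus (tsupport_mul_subset_right hx))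
      (hφℓ _ (hsub (tsupport_mul_subset_left hx)))
  have key := mul_integral_sq_le_of_localized hu huc hφ hφc hδ hloc
  have hU : 0 ≤ ∫ x, u x ^ 2 := by positivity
  set U := ∫ x, u x ^ 2
  set G := ∫ x, ‖fderiv ℝ u x‖ ^ 2
  set P := ∫ x, φ x ^ 2
  set Q := ∫ x, ‖fderiv ℝ φ x‖ ^ 2
  have h1 : μ / (1 + δ) ^ 2 * U ≤ (1 + δ) * (G + ε / 2 * U) := by
    refine le_of_mul_le_mul_right ?_ hφpos
    calc μ / (1 + δ) ^ 2 * U * P = μ / (1 + δ) ^ 2 * (U * P) := by ring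
      _ ≤ (1 + δ) * (G * P) + (1 + δ⁻¹) * (U * Q) := key
      _ ≤ (1 + δ) * (G * P) + (1 + δ⁻¹) * (U * (δ * ε / 2 * P)) := by gcongr
      _ = (1 + δ) * (G + ε / 2 * U) * P := by field_simp; ring
  have h2 : μ * (1 - 3 * δ) * (1 + δ) ≤ μ / (1 + δ) ^ 2 := by
    rw [le_div_iff₀ (by positivity)]
    have : (1 - 3 * δ) * (1 + δ) * (1 + δ) ^ 2 ≤ 1 := by
      have : 0 ≤ 6 * δ ^ 2 + 8 * δ ^ 3 + 3 * δ ^ 4 := by positivity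
      linarith
    nlinarith [mul_le_mul_of_nonneg_left this hμ]
  have h3 : μ * (1 - 3 * δ) * U ≤ G + ε / 2 * U := by
    refine le_of_mul_le_mul_left ?_ hr
    calc (1 + δ) * (μ * (1 - 3 * δ) * U) = μ * (1 - 3 * δ) * (1 + δ) * U := by ring
      _ ≤ μ / (1 + δ) ^ 2 * U := by gcongr
      _ ≤ _ := h1
  nlinarith [mul_le_mul_of_nonneg_right hδε hU]
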